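/- Let ρ₁ and ρ₂ be independent real random variables, each exponentially distributed with rate 1, and let μ₁, μ₂ > 0 be reals. Then P(μ₁ρ₁ + μ₂ρ₂ ≤ 2) ≤ 16/((1 + μ₁)(1 + μ₂)). -/

import Mathlib

open MeasureTheory ProbabilityTheory

section ExponentialRandomVariable

variable {Ω : Type*} [MeasurableSpace Ω] {P : Measure Ω} {ρ : Ω → ℝ}

/-- The distribution function of an exponential random variable of rate `1`. -/
lemma measureReal_le_of_map_eq_expMeasure_one (hρ : Measurable ρ)
    (hmap : P.map ρ = expMeasure 1) {t : ℝ} (ht : 0 ≤ t) :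
    P.real (ρ ⁻¹' Set.Iic t) = 1 - Real.exp (-t) := by
  have := isProbabilityMeasure_expMeasure one_pos
  rw [← map_measureReal_apply hρ measurableSet_Iic, hmap, ← cdf_eq_real,
    cdf_expMeasure_eq one_pos, if_pos ht, one_mul]

lemma ae_pos_of_map_eq_expMeasure_one [IsFiniteMeasure P] (hρ : Measurable ρ)
    (hmap : P.map ρ = expMeasure 1) : ∀ᵐ ω ∂P, 0 < ρ ω := by
  have h : P.real (ρ ⁻¹' Set.Iic 0) = 0 := by
    simp [measureReal_le_of_map_eq_expMeasure_one hρ hmap le_rfl]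
  rw [measureReal_eq_zero_iff] at h
  simpa [ae_iff, Set.preimage] using h

lemma measureReal_le_two_div_le (hρ : Measurable ρ) (hmap : P.map ρ = expMeasure 1)
    {μ : ℝ} (hμ : 0 < μ) : P.real (ρ ⁻¹' Set.Iic (2 / μ)) ≤ 4 / (1 + μ) := by
  rw [measureReal_le_of_map_eq_expMeasure_one hρ hmap (by positivity)]
  rcases le_total μ 1 with h | h
  · have : 1 ≤ 4 / (1 + μ) := by rw [le_div_iff₀ (by positivity)]; linarith
    linarith [Real.exp_pos (-(2 / μ))]
  · have : 2 / μ ≤ 4 / (1 + μ) := by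
      rw [div_le_div_iff₀ hμ (by positivity)]; linarith
    linarith [Real.add_one_le_exp (-(2 / μ))]

end ExponentialRandomVariable

/-- If `ρ₁, ρ₂` are independent rate-1 exponential random variables and `μ₁, μ₂ > 0`,
then `P(μ₁ρ₁ + μ₂ρ₂ ≤ 2) ≤ 16/((1 + μ₁)(1 + μ₂))`. -/
theorem stmt_6 {Ω : Type*} [MeasurableSpace Ω] (P : Measure Ω) [IsProbabilityMeasure P]
    (ρ₁ ρ₂ : Ω → ℝ) (hρ₁ : Measurable ρ₁) (hρ₂ : Measurable ρ₂)
    (hindep : IndepFun ρ₁ ρ₂ P)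
    (hmap₁ : P.map ρ₁ = expMeasure 1) (hmap₂ : P.map ρ₂ = expMeasure 1)
    (μ₁ μ₂ : ℝ) (hμ₁ : 0 < μ₁) (hμ₂ : 0 < μ₂) :
    (P {ω | μ₁ * ρ₁ ω + μ₂ * ρ₂ ω ≤ 2}).toReal ≤ 16 / ((1 + μ₁) * (1 + μ₂)) := by
  have hsub : P {ω | μ₁ * ρ₁ ω + μ₂ * ρ₂ ω ≤ 2} ≤
      P (ρ₁ ⁻¹' Set.Iic (2 / μ₁) ∩ ρ₂ ⁻¹' Set.Iic (2 / μ₂)) := by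
    apply measure_mono_ae
    filter_upwards [ae_pos_of_map_eq_expMeasure_one hρ₁ hmap₁,
      ae_pos_of_map_eq_expMeasure_one hρ₂ hmap₂] with ω h₁ h₂ hω
    have hω : μ₁ * ρ₁ ω + μ₂ * ρ₂ ω ≤ 2 := hω
    have h₁ := mul_pos hμ₁ h₁
    have h₂ := mul_pos hμ₂ h₂
    constructor
    · change ρ₁ ω ≤ 2 / μ₁
      rw [le_div_iff₀ hμ₁]; linarith
    · change ρ₂ ω ≤ 2 / μ₂
      rw [le_div_iff₀ hμ₂]; linarith
  rw [hindep.measure_inter_preimage_eq_mul _ _ measurableSet_Iic measurableSet_Iic] at hsub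
  calc (P {ω | μ₁ * ρ₁ ω + μ₂ * ρ₂ ω ≤ 2}).toReal
      ≤ P.real (ρ₁ ⁻¹' Set.Iic (2 / μ₁)) * P.real (ρ₂ ⁻¹' Set.Iic (2 / μ₂)) := by
        rw [measureReal_def, measureReal_def, ← ENNReal.toReal_mul]
        exact ENNReal.toReal_mono (by finiteness) hsub
    _ ≤ 4 / (1 + μ₁) * (4 / (1 + μ₂)) := by
        gcongr
        · exact measureReal_le_two_div_le hρ₁ hmap₁ hμ₁
        · exact measureReal_le_two_div_le hρ₂ hmap₂ hμ₂
    _ = 16 / ((1 + μ₁) * (1 + μ₂)) := by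
        rw [div_mul_div_comm]; norm_num
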